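/- Let p > 3 be a prime. Then, computing in ℤ/pℤ, Σ_{n=0}^{p-1} (Σ_{k=0}^{n} C(n,k)·C(2k,k)·(2⁻¹)^k)·(Σ_{k=0}^{n} C(n,k)·C(2k,k)·((-6)⁻¹)^k) = (3/p), where (·/p) is the Legendre symbol. -/

import Mathlib

open Polynomial in
theorem ZMod.sum_eval_eq_neg_coeff {p : ℕ} [Fact p.Prime] (f : (ZMod p)[X])
    (hf : f.natDegree ≤ p - 1) : ∑ x : ZMod p, f.eval x = -f.coeff (p - 1) := by
  have hp : 1 < p := (Fact.out : p.Prime).one_lt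
  have htop : ∑ x : ZMod p, x ^ (p - 1) = -1 := by
    have hterm (x : ZMod p) : x ^ (p - 1) = 1 - if x = 0 then 1 else 0 := by
      split_ifs with hx
      · simp [hx, Nat.sub_ne_zero_of_lt hp]
      · rw [ZMod.pow_card_sub_one_eq_one hx, sub_zero]
    simp [hterm, Finset.sum_sub_distrib]
  simp_rw [eval_eq_sum_range' (Nat.lt_succ_of_le hf)]
  rw [Finset.sum_comm, Finset.sum_range_succ]
  simp_rw [← Finset.mul_sum]
  rw [htop, Finset.sum_eq_zero]
  · simp
  · intro i hi
    rw [FiniteField.sum_pow_lt_card_sub_one, mul_zero]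
    simpa [ZMod.card] using hi

theorem ZMod.sum_range_natCast {p : ℕ} [Fact p.Prime] (f : ZMod p → ZMod p) :
    ∑ n ∈ Finset.range p, f n = ∑ x : ZMod p, f x := by
  refine Finset.sum_bij' (fun n _ => (n : ZMod p)) (fun x _ => x.val) ?_ ?_ ?_ ?_ ?_
  · simp
  · intro x _
    simpa using ZMod.val_lt x
  · intro n hn
    exact ZMod.val_natCast_of_lt (Finset.mem_range.mp hn)
  · intro x _
    simp
  · simp

theorem ZMod.natCast_choose_prime_sub_one {p : ℕ} [Fact p.Prime] {k : ℕ} (hk : k < p) :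
    ((p - 1).choose k : ZMod p) = (-1) ^ k := by
  have hp : p.Prime := Fact.out
  induction k with
  | zero => simp
  | succ k ih =>
    have h0 : (p.choose (k + 1) : ZMod p) = 0 :=
      (ZMod.natCast_eq_zero_iff _ _).mpr (hp.dvd_choose_self k.succ_ne_zero hk)
    have h1 : p.choose (k + 1) = (p - 1).choose k + (p - 1).choose (k + 1) := by
      conv_lhs => rw [← Nat.sub_add_cancel hp.one_le]
      exact Nat.choose_succ_succ _ _
    rw [h1, Nat.cast_add, ih (by omega)] at h0
    rw [pow_succ]
    linear_combination h0

/-- The polynomial interpolating `n ↦ ∑ k, C(n, k) * C(2k, k) * x ^ k` modulo `p`,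
truncated at `k = m`. -/
noncomputable def centralBinomTransform {F : Type*} [Field F] (m : ℕ) (x : F) : Polynomial F :=
  ∑ k ∈ Finset.range (m + 1),
    Polynomial.C (((2 * k).choose k : F) * x ^ k * (k.factorial : F)⁻¹) * descPochhammer F k

theorem natDegree_centralBinomTransform_le {F : Type*} [Field F] (m : ℕ) (x : F) :
    (centralBinomTransform m x).natDegree ≤ m := by
  refine Polynomial.natDegree_sum_le_of_forall_le _ _ fun k hk => ?_
  refine (Polynomial.natDegree_C_mul_le _ _).trans ?_
  rw [descPochhammer_natDegree]
  exact Nat.lt_succ_iff.mp (Finset.mem_range.mp hk)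

theorem coeff_centralBinomTransform {F : Type*} [Field F] (m : ℕ) (x : F) :
    (centralBinomTransform m x).coeff m =
      ((2 * m).choose m : F) * x ^ m * (m.factorial : F)⁻¹ := by
  have hlead : (descPochhammer F m).coeff m = 1 := by
    simpa [Polynomial.Monic, Polynomial.leadingCoeff, descPochhammer_natDegree] using
      monic_descPochhammer F m
  rw [centralBinomTransform, Polynomial.finsetSum_coeff, Finset.sum_range_succ,
    Finset.sum_eq_zero, Polynomial.coeff_C_mul, hlead, zero_add, mul_one]
  intro k hk
  rw [Polynomial.coeff_C_mul, Polynomial.coeff_eq_zero_of_natDegree_lt, mul_zero]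
  rw [descPochhammer_natDegree]
  exact Finset.mem_range.mp hk

theorem eval_centralBinomTransform {p m : ℕ} [Fact p.Prime] (hm : p = 2 * m + 1) (x : ZMod p)
    {n : ℕ} (hn : n < p) :
    (centralBinomTransform m x).eval (n : ZMod p) =
      ∑ k ∈ Finset.range (n + 1), (n.choose k : ZMod p) * ((2 * k).choose k : ZMod p) * x ^ k := by
  have hp : p.Prime := Fact.out
  trans ∑ k ∈ Finset.range p, (n.choose k : ZMod p) * ((2 * k).choose k : ZMod p) * x ^ k
  · rw [centralBinomTransform, Polynomial.eval_finsetSum]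
    have hsub : Finset.range (m + 1) ⊆ Finset.range p := Finset.range_subset_range.mpr (by omega)
    rw [← Finset.sum_subset hsub]
    · refine Finset.sum_congr rfl fun k hk => ?_
      have hkp : k < p := Finset.mem_range.mp (hsub hk)
      have hfac : (k.factorial : ZMod p) ≠ 0 := by
        rw [Ne, ZMod.natCast_eq_zero_iff, hp.dvd_factorial]
        omega
      rw [Polynomial.eval_mul, Polynomial.eval_C, descPochhammer_eval_eq_descFactorial,
        Nat.descFactorial_eq_factorial_mul_choose, Nat.cast_mul]
      field_simp
    · intro k hk hkm
      rw [Finset.mem_range] at hk hkm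
      have hdvd : p ∣ (2 * k).choose k := hp.dvd_choose hk (by omega) (by omega)
      rw [(ZMod.natCast_eq_zero_iff _ _).mpr hdvd, mul_zero, zero_mul]
  · refine (Finset.sum_subset (Finset.range_subset_range.mpr hn) fun k _ hk => ?_).symm
    rw [Finset.mem_range] at hk
    rw [Nat.choose_eq_zero_of_lt (by omega), Nat.cast_zero, zero_mul, zero_mul]

theorem sum_mul_sum_choose_centralBinom {p m : ℕ} [Fact p.Prime] (hm : p = 2 * m + 1)
    (x y : ZMod p) :
    ∑ n ∈ Finset.range p,
        (∑ k ∈ Finset.range (n + 1),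
          (n.choose k : ZMod p) * ((2 * k).choose k : ZMod p) * x ^ k) *
        (∑ k ∈ Finset.range (n + 1),
          (n.choose k : ZMod p) * ((2 * k).choose k : ZMod p) * y ^ k) = (-(x * y)) ^ m := by
  have hm' : p - 1 = 2 * m := by omega
  have hdeg := Polynomial.natDegree_mul_le_of_le (natDegree_centralBinomTransform_le m x)
    (natDegree_centralBinomTransform_le m y)
  have hpoly : ∑ n ∈ Finset.range p,
      (centralBinomTransform m x * centralBinomTransform m y).eval (n : ZMod p) =
        -(centralBinomTransform m x * centralBinomTransform m y).coeff (m + m) := by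
    rw [ZMod.sum_range_natCast
        fun t => (centralBinomTransform m x * centralBinomTransform m y).eval t,
      ZMod.sum_eval_eq_neg_coeff _ (by omega), hm', two_mul]
  have hchoose : ((2 * m).choose m : ZMod p) = (-1) ^ m := by
    rw [← hm', ZMod.natCast_choose_prime_sub_one (by omega)]
  have hsq : ((2 * m).choose m : ZMod p) ^ 2 = 1 := by
    rw [hchoose, ← pow_mul, mul_comm, pow_mul, neg_one_sq, one_pow]
  have hwilson : ((2 * m).choose m : ZMod p) * m.factorial * m.factorial = -1 := by
    rw [← ZMod.wilsons_lemma p, hm',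
      ← Nat.choose_mul_factorial_mul_factorial (show m ≤ 2 * m by omega),
      show 2 * m - m = m by omega]
    push_cast
    rfl
  trans ∑ n ∈ Finset.range p,
      (centralBinomTransform m x * centralBinomTransform m y).eval (n : ZMod p)
  · refine Finset.sum_congr rfl fun n hn => ?_
    rw [Polynomial.eval_mul, eval_centralBinomTransform hm x (Finset.mem_range.mp hn),
      eval_centralBinomTransform hm y (Finset.mem_range.mp hn)]
  rw [hpoly, Polynomial.coeff_mul_add_eq_of_natDegree_le
      (natDegree_centralBinomTransform_le m x) (natDegree_centralBinomTransform_le m y),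
    coeff_centralBinomTransform, coeff_centralBinomTransform, neg_pow, mul_pow, ← hchoose]
  have hfac : (m.factorial : ZMod p) ≠ 0 := by
    intro h
    simp [h] at hwilson
  field_simp
  linear_combination -(x ^ m * y ^ m) * hsq - x ^ m * y ^ m * hwilson

theorem stmt_6 (p : ℕ) [Fact (Nat.Prime p)] (hp3 : 3 < p) :
    ∑ n ∈ Finset.range p,
        (∑ k ∈ Finset.range (n + 1),
          (n.choose k : ZMod p) * ((2 * k).choose k : ZMod p) * ((2 : ZMod p)⁻¹) ^ k) *
        (∑ k ∈ Finset.range (n + 1),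
          (n.choose k : ZMod p) * ((2 * k).choose k : ZMod p) * ((-6 : ZMod p)⁻¹) ^ k) =
      (legendreSym p 3 : ZMod p) := by
  have hp : p.Prime := Fact.out
  have hm : p = 2 * (p / 2) + 1 := by
    have := hp.eq_two_or_odd
    omega
  have hne {k : ℕ} (hk : 0 < k) (hkp : k < p) : (k : ZMod p) ≠ 0 := by
    rw [Ne, ZMod.natCast_eq_zero_iff]
    exact Nat.not_dvd_of_pos_of_lt hk hkp
  have h2 : (2 : ZMod p) ≠ 0 := by exact_mod_cast hne two_pos (by omega)
  have h3 : (3 : ZMod p) ≠ 0 := by exact_mod_cast hne three_pos hp3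
  have h6 : (6 : ZMod p) ≠ 0 := by
    rw [show (6 : ZMod p) = 2 * 3 by norm_num]
    exact mul_ne_zero h2 h3
  have hsq : ((6 : ZMod p)⁻¹ ^ 2) ^ (p / 2) = 1 := by
    rw [← pow_mul, show 2 * (p / 2) = p - 1 by omega,
      ZMod.pow_card_sub_one_eq_one (inv_ne_zero h6)]
  rw [sum_mul_sum_choose_centralBinom hm, legendreSym.eq_pow, Int.cast_ofNat,
    show -((2 : ZMod p)⁻¹ * (-6)⁻¹) = 3 * (6⁻¹) ^ 2 by
      rw [inv_neg]
      field_simp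
      norm_num,
    mul_pow, hsq, mul_one]
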